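/- Let n ≥ 1, b ≥ 1 be integers, γ = 1/(2b), let s > n/2 + b, and let φ : [1,∞) → (0,∞) be measurable with φ, 1/φ bounded on compact intervals of [1,∞). For a multi-index α ∈ ℤ₊ⁿ and β ∈ ℤ₊, set δ = s − n/2 − b − |α| − 2bβ and assume δ ≥ 0. Then there is a positive constant c (depending only on n, b, α, β) such that ∫_{ℝⁿ}∫_ℝ |ξ^α|² |η|^{2β} / ( r_γ(ξ,η)^{2s} φ(r_γ(ξ,η))² ) dξ dη = c · ∫₁^∞ (r² − 1)^{s−1−δ} / ( r^{2s−1} φ(r)² ) dr, where r_γ(ξ,η) = (1 + |ξ|² + |η|^{2γ})^{1/2}, with both sides simultaneously finite or infinite. -/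

import Mathlib

open MeasureTheory Set

/-- The anisotropic weight r_γ(ξ,η) = (1 + |ξ|² + |η|^{2γ})^{1/2}. -/
noncomputable def rgam (n : ℕ) (γ : ℝ) (q : (Fin n → ℝ) × ℝ) : ℝ :=
  Real.sqrt (1 + (∑ i, (q.1 i) ^ 2) + |q.2| ^ (2 * γ))

/-- The monomial weight `|ξ^α|² |η|^{2β}`. -/
noncomputable def monomialWeight {n : ℕ} (α : Fin n → ℕ) (β : ℕ) (q : (Fin n → ℝ) × ℝ) : ℝ :=
  (∏ i, |q.1 i| ^ (α i)) ^ 2 * |q.2| ^ (2 * β)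

/-- The anisotropic gauge `|ξ|² + |η|^{1/b}`. -/
noncomputable def anisotropicGauge (n b : ℕ) (q : (Fin n → ℝ) × ℝ) : ℝ :=
  (∑ i, (q.1 i) ^ 2) + |q.2| ^ (2 * (1 / (2 * (b : ℝ))))

/-- The anisotropic dilation `(ξ, η) ↦ (√t ξ, t^b η)`. -/
noncomputable def anisotropicDilation (n b : ℕ) (t : ℝ) :
    ((Fin n → ℝ) × ℝ) →ₗ[ℝ] ((Fin n → ℝ) × ℝ) :=
  LinearMap.prodMap (Real.sqrt t • LinearMap.id) (t ^ b • LinearMap.id)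

/-- The measure with density `|ξ^α|² |η|^{2β}`. -/
noncomputable def monomialMeasure {n : ℕ} (α : Fin n → ℕ) (β : ℕ) : Measure ((Fin n → ℝ) × ℝ) :=
  volume.withDensity fun q => ENNReal.ofReal (monomialWeight α β q)

/-- The homogeneity degree of the weighted volume of gauge balls. -/
noncomputable def homDegree {n : ℕ} (b : ℕ) (α : Fin n → ℕ) (β : ℕ) : ℝ :=
  (n : ℝ) / 2 + b + (∑ i, (α i : ℝ)) + 2 * b * β

section Gauge

variable {n b : ℕ} {α : Fin n → ℕ} {β : ℕ}

theorem continuous_monomialWeight : Continuous (monomialWeight α β) := by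
  unfold monomialWeight
  fun_prop

theorem monomialWeight_nonneg (q : (Fin n → ℝ) × ℝ) : 0 ≤ monomialWeight α β q := by
  unfold monomialWeight
  positivity

theorem continuous_anisotropicGauge : Continuous (anisotropicGauge n b) := by
  unfold anisotropicGauge
  refine Continuous.add (by fun_prop) ?_
  exact (continuous_abs.comp continuous_snd).rpow_const fun _ => Or.inr (by positivity)

theorem anisotropicGauge_nonneg (q : (Fin n → ℝ) × ℝ) : 0 ≤ anisotropicGauge n b q := by
  unfold anisotropicGauge
  positivity

theorem pow_rpow_two_mul_inv (hb : 1 ≤ b) {t : ℝ} (ht : 0 ≤ t) :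
    (t ^ b) ^ (2 * (1 / (2 * (b : ℝ)))) = t := by
  have hb' : (b : ℝ) ≠ 0 := by positivity
  rw [← Real.rpow_natCast, ← Real.rpow_mul ht]
  have : (b : ℝ) * (2 * (1 / (2 * (b : ℝ)))) = 1 := by field_simp
  rw [this, Real.rpow_one]

theorem anisotropicGauge_dilation (hb : 1 ≤ b) {t : ℝ} (ht : 0 ≤ t) (q : (Fin n → ℝ) × ℝ) :
    anisotropicGauge n b (anisotropicDilation n b t q) = t * anisotropicGauge n b q := by
  simp only [anisotropicGauge, anisotropicDilation, LinearMap.prodMap_apply, LinearMap.smul_apply,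
    LinearMap.id_apply, Pi.smul_apply, smul_eq_mul, mul_pow, Real.sq_sqrt ht, abs_mul]
  rw [abs_of_nonneg (pow_nonneg ht b), Real.mul_rpow (pow_nonneg ht b) (abs_nonneg _),
    pow_rpow_two_mul_inv hb ht, ← Finset.mul_sum, mul_add]

theorem monomialWeight_dilation {t : ℝ} (ht : 0 ≤ t) (q : (Fin n → ℝ) × ℝ) :
    monomialWeight α β (anisotropicDilation n b t q) =
      t ^ ((∑ i, α i) + 2 * b * β) * monomialWeight α β q := by
  simp only [monomialWeight, anisotropicDilation, LinearMap.prodMap_apply, LinearMap.smul_apply,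
    LinearMap.id_apply, Pi.smul_apply, smul_eq_mul, abs_mul, mul_pow, Finset.prod_mul_distrib,
    Finset.prod_pow_eq_pow_sum]
  rw [abs_of_nonneg (pow_nonneg ht b), abs_of_nonneg (Real.sqrt_nonneg t), ← pow_mul,
    mul_comm (∑ i, α i) 2, pow_mul, Real.sq_sqrt ht, ← pow_mul, pow_add]
  ring

theorem det_anisotropicDilation (t : ℝ) :
    LinearMap.det (anisotropicDilation n b t) = Real.sqrt t ^ n * t ^ b := by
  simp [anisotropicDilation, LinearMap.det_prodMap, LinearMap.det_smul]

instance isAddHaarMeasure_volume_prod :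
    (volume : Measure ((Fin n → ℝ) × ℝ)).IsAddHaarMeasure :=
  Measure.prod.instIsAddHaarMeasure _ _

theorem rpow_homDegree {t : ℝ} (ht : 0 < t) :
    t ^ homDegree b α β = Real.sqrt t ^ n * t ^ b * t ^ ((∑ i, α i) + 2 * b * β) := by
  have h : homDegree b α β = 1 / 2 * (n : ℝ) + (b : ℝ) + (((∑ i, α i) + 2 * b * β : ℕ) : ℝ) := by
    unfold homDegree
    push_cast
    ring
  rw [h, Real.rpow_add ht, Real.rpow_add ht, Real.rpow_mul ht.le, ← Real.sqrt_eq_rpow,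
    Real.rpow_natCast, Real.rpow_natCast, Real.rpow_natCast]

theorem measurableSet_gauge_le (t : ℝ) : MeasurableSet {q | anisotropicGauge n b q ≤ t} :=
  measurableSet_le continuous_anisotropicGauge.measurable measurable_const

theorem measurable_ofReal_monomialWeight :
    Measurable fun q => ENNReal.ofReal (monomialWeight α β q) :=
  continuous_monomialWeight.measurable.ennreal_ofReal

theorem monomialMeasure_gauge_le_eq (hb : 1 ≤ b) {t : ℝ} (ht : 0 < t) :
    monomialMeasure α β {q | anisotropicGauge n b q ≤ t} =
      ENNReal.ofReal (t ^ homDegree b α β) *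
        monomialMeasure α β {q | anisotropicGauge n b q ≤ 1} := by
  set D := LinearMap.det (anisotropicDilation n b t) with hD
  have hDpos : 0 < D := by
    rw [hD, det_anisotropicDilation]
    positivity
  have hmap := Measure.map_linearMap_addHaar_eq_smul_addHaar
    (volume : Measure ((Fin n → ℝ) × ℝ)) (f := anisotropicDilation n b t) hDpos.ne'
  have hmeas : Measurable (anisotropicDilation n b t) :=
    (LinearMap.continuous_of_finiteDimensional _).measurable
  have hvol : (volume : Measure ((Fin n → ℝ) × ℝ)) =
      ENNReal.ofReal D • Measure.map (anisotropicDilation n b t) volume := by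
    rw [hmap, smul_smul, ← ENNReal.ofReal_mul hDpos.le, ← hD, abs_of_pos (inv_pos.2 hDpos),
      mul_inv_cancel₀ hDpos.ne', ENNReal.ofReal_one, one_smul]
  have hpre : anisotropicDilation n b t ⁻¹' {q | anisotropicGauge n b q ≤ t} =
      {q | anisotropicGauge n b q ≤ 1} := by
    ext q
    simp only [mem_preimage, mem_ofPred_eq, anisotropicGauge_dilation hb ht.le]
    exact mul_le_iff_le_one_right ht
  unfold monomialMeasure
  rw [withDensity_apply _ (measurableSet_gauge_le t), withDensity_apply _ (measurableSet_gauge_le 1)]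
  conv_lhs => rw [hvol]
  rw [Measure.restrict_smul, lintegral_smul_measure,
    setLIntegral_map (measurableSet_gauge_le t) measurable_ofReal_monomialWeight hmeas, hpre]
  simp only [monomialWeight_dilation ht.le]
  simp_rw [ENNReal.ofReal_mul (pow_nonneg ht.le ((∑ i, α i) + 2 * b * β))]
  rw [lintegral_const_mul _ measurable_ofReal_monomialWeight, smul_eq_mul, ← mul_assoc,
    ← ENNReal.ofReal_mul hDpos.le, hD, det_anisotropicDilation, ← rpow_homDegree ht]

theorem monomialMeasure_gauge_le_nonpos (hb : 1 ≤ b) {t : ℝ} (ht : t ≤ 0) :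
    monomialMeasure α β {q | anisotropicGauge n b q ≤ t} = 0 := by
  refine withDensity_absolutelyContinuous _ _ (measure_mono_null ?_ (measure_singleton 0))
  intro q hq
  have h : anisotropicGauge n b q ≤ 0 := le_trans hq ht
  unfold anisotropicGauge at h
  have h1 : 0 ≤ ∑ i, (q.1 i) ^ 2 := by positivity
  have h2 : 0 ≤ |q.2| ^ (2 * (1 / (2 * (b : ℝ)))) := by positivity
  have h3 : ∑ i, (q.1 i) ^ 2 = 0 := by linarith
  have h4 : |q.2| ^ (2 * (1 / (2 * (b : ℝ)))) = 0 := by linarith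
  rw [Finset.sum_eq_zero_iff_of_nonneg fun i _ => sq_nonneg _] at h3
  have hb' : (0 : ℝ) < b := by positivity
  rw [Real.rpow_eq_zero (abs_nonneg _) (by positivity), abs_eq_zero] at h4
  refine Prod.ext (funext fun i => ?_) h4
  simpa using h3 i (Finset.mem_univ i)

theorem monomialMeasure_gauge_le_one_lt_top (hb : 1 ≤ b) :
    monomialMeasure α β {q | anisotropicGauge n b q ≤ 1} < ⊤ := by
  have hsub : {q | anisotropicGauge n b q ≤ 1} ⊆ Icc ((fun _ => -1, -1) : (Fin n → ℝ) × ℝ)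
      (fun _ => 1, 1) := by
    intro q hq
    have h : anisotropicGauge n b q ≤ 1 := hq
    unfold anisotropicGauge at h
    have h1 : 0 ≤ ∑ i, (q.1 i) ^ 2 := by positivity
    have h2 : 0 ≤ |q.2| ^ (2 * (1 / (2 * (b : ℝ)))) := by positivity
    have hb' : (0 : ℝ) < b := by positivity
    have h3 (i : Fin n) : |q.1 i| ≤ 1 := by
      have := Finset.single_le_sum (f := fun i => (q.1 i) ^ 2) (fun i _ => sq_nonneg _)
        (Finset.mem_univ i)
      exact (sq_le_one_iff_abs_le_one _).1 (by linarith)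
    have h4 : |q.2| ≤ 1 := by
      by_contra! hlt
      have := Real.one_lt_rpow hlt (z := 2 * (1 / (2 * (b : ℝ)))) (by positivity)
      linarith
    exact ⟨⟨fun i => (abs_le.1 (h3 i)).1, (abs_le.1 h4).1⟩,
      ⟨fun i => (abs_le.1 (h3 i)).2, (abs_le.1 h4).2⟩⟩
  refine (measure_mono hsub).trans_lt ?_
  unfold monomialMeasure
  rw [withDensity_apply _ measurableSet_Icc]
  exact (continuous_monomialWeight.continuousOn.integrableOn_compact
    isCompact_Icc).setLIntegral_lt_top

theorem monomialMeasure_gauge_le_one_pos (hb : 1 ≤ b) :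
    0 < monomialMeasure α β {q | anisotropicGauge n b q ≤ 1} := by
  have ht : (0 : ℝ) < n + 2 := by positivity
  have hpos : 0 < monomialMeasure α β {q | anisotropicGauge n b q ≤ n + 2} := by
    unfold monomialMeasure
    rw [withDensity_apply _ (measurableSet_gauge_le _),
      setLIntegral_pos_iff measurable_ofReal_monomialWeight]
    have hopen : IsOpen ({q | 0 < monomialWeight α β q} ∩ {q | anisotropicGauge n b q < n + 2}) :=
      (isOpen_lt continuous_const continuous_monomialWeight).inter
        (isOpen_lt continuous_anisotropicGauge continuous_const)
    refine (hopen.measure_pos volume ⟨(fun _ => 1, 1), ?_, ?_⟩).trans_le (measure_mono ?_)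
    · simp [monomialWeight]
    · simp [anisotropicGauge]
    · rintro q ⟨h1, h2⟩
      exact ⟨by simpa using h1, le_of_lt (mem_ofPred_eq ▸ h2)⟩
  rw [monomialMeasure_gauge_le_eq hb ht] at hpos
  exact pos_of_ne_zero (right_ne_zero_of_mul hpos.ne')

theorem rgam_eq (q : (Fin n → ℝ) × ℝ) :
    rgam n (1 / (2 * (b : ℝ))) q = Real.sqrt (1 + anisotropicGauge n b q) := by
  rw [rgam, anisotropicGauge, add_assoc]

theorem one_le_rgam (q : (Fin n → ℝ) × ℝ) : 1 ≤ rgam n (1 / (2 * (b : ℝ))) q := by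
  rw [rgam_eq, Real.one_le_sqrt]
  linarith [anisotropicGauge_nonneg (b := b) q]

theorem continuous_rgam : Continuous (rgam n (1 / (2 * (b : ℝ)))) := by
  simp only [funext rgam_eq]
  exact (continuous_const.add continuous_anisotropicGauge).sqrt

theorem rgam_le_iff {r : ℝ} (hr : 0 ≤ r) (q : (Fin n → ℝ) × ℝ) :
    rgam n (1 / (2 * (b : ℝ))) q ≤ r ↔ anisotropicGauge n b q ≤ r ^ 2 - 1 := by
  rw [rgam_eq, Real.sqrt_le_left hr, le_sub_iff_add_le, add_comm]

theorem one_le_homDegree (hb : 1 ≤ b) : 1 ≤ homDegree b α β := by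
  have : (1 : ℝ) ≤ b := by exact_mod_cast hb
  have h : 0 ≤ (n : ℝ) / 2 + (∑ i, (α i : ℝ)) + 2 * b * β := by positivity
  unfold homDegree
  linarith

end Gauge

section Radial

/-- The measure `2κ r (r² - 1)^{κ - 1} dr` on `[1, ∞)`. -/
noncomputable def radialMeasure (κ : ℝ) : Measure ℝ :=
  (volume.restrict (Ici 1)).withDensity fun r =>
    ENNReal.ofReal (2 * r * κ * (r ^ 2 - 1) ^ (κ - 1))

theorem continuous_radialDensity {κ : ℝ} (hκ : 1 ≤ κ) :
    Continuous fun r : ℝ => 2 * r * κ * (r ^ 2 - 1) ^ (κ - 1) := by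
  refine Continuous.mul (by fun_prop) ?_
  exact Continuous.rpow_const (by fun_prop) fun _ => Or.inr (by linarith)

theorem radialMeasure_Iic {κ r : ℝ} (hκ : 1 ≤ κ) (hr : 1 ≤ r) :
    radialMeasure κ (Iic r) = ENNReal.ofReal ((r ^ 2 - 1) ^ κ) := by
  have hderiv (x : ℝ) : HasDerivAt (fun y : ℝ => (y ^ 2 - 1) ^ κ)
      (2 * x * κ * (x ^ 2 - 1) ^ (κ - 1)) x := by
    have h : HasDerivAt (fun y : ℝ => y ^ 2 - 1) (2 * x) x := by
      simpa using (hasDerivAt_pow 2 x).sub_const 1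
    exact h.rpow_const (Or.inr hκ)
  have hint := intervalIntegral.integral_eq_sub_of_hasDerivAt (a := 1) (b := r)
    (fun x _ => hderiv x) ((continuous_radialDensity hκ).intervalIntegrable _ _)
  rw [intervalIntegral.integral_of_le hr] at hint
  unfold radialMeasure
  rw [withDensity_apply _ measurableSet_Iic, Measure.restrict_restrict measurableSet_Iic,
    inter_comm, Ici_inter_Iic, ← restrict_Ioc_eq_restrict_Icc,
    ← ofReal_integral_eq_lintegral_ofReal, hint]
  · rw [one_pow, sub_self, Real.zero_rpow (by linarith), sub_zero]
  · exact ((continuous_radialDensity hκ).integrableOn_Icc).mono_set Ioc_subset_Icc_self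
  · filter_upwards [ae_restrict_mem measurableSet_Ioc] with x hx
    have hx1 : 0 ≤ x ^ 2 - 1 := by nlinarith [hx.1]
    have hx0 : 0 ≤ x := by linarith [hx.1]
    have := Real.rpow_nonneg hx1 (κ - 1)
    simp only [Pi.zero_apply]
    positivity

theorem radialMeasure_Iic_of_lt {κ r : ℝ} (hr : r < 1) : radialMeasure κ (Iic r) = 0 := by
  unfold radialMeasure
  rw [withDensity_apply _ measurableSet_Iic, Measure.restrict_restrict measurableSet_Iic,
    inter_comm, Ici_inter_Iic, Icc_eq_empty (not_le.2 hr), Measure.restrict_empty,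
    lintegral_zero_measure]

theorem lintegral_radialMeasure {κ : ℝ} (hκ : 1 ≤ κ) {G : ℝ → ENNReal} (hG : Measurable G) :
    ∫⁻ r, G r ∂radialMeasure κ =
      ∫⁻ r in Ici (1 : ℝ), ENNReal.ofReal (2 * r * κ * (r ^ 2 - 1) ^ (κ - 1)) * G r := by
  unfold radialMeasure
  rw [lintegral_withDensity_eq_lintegral_mul _
    (continuous_radialDensity hκ).measurable.ennreal_ofReal hG]
  rfl

end Radial

theorem measure_ext_of_Iic_ne_top {μ ν : Measure ℝ} (hfin : ∀ r, μ (Iic r) ≠ ⊤)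
    (h : ∀ r, μ (Iic r) = ν (Iic r)) : μ = ν := by
  refine Measure.ext_of_Ioc' μ ν (fun a b _ => ?_) fun a b hab => ?_
  · exact ((measure_mono Ioc_subset_Iic_self).trans_lt (hfin b).lt_top).ne
  · have hd : Ioc a b = Iic b \ Iic a := by
      ext x
      simp [and_comm]
    rw [hd, measure_sdiff (Iic_subset_Iic.2 hab.le) measurableSet_Iic.nullMeasurableSet (hfin a),
      measure_sdiff (Iic_subset_Iic.2 hab.le) measurableSet_Iic.nullMeasurableSet (h a ▸ hfin a),
      h, h]

theorem map_rgam_monomialMeasure {n b : ℕ} (hb : 1 ≤ b) (α : Fin n → ℕ) (β : ℕ) :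
    (monomialMeasure α β).map (rgam n (1 / (2 * (b : ℝ)))) =
      monomialMeasure α β {q | anisotropicGauge n b q ≤ 1} • radialMeasure (homDegree b α β) := by
  have hκ := one_le_homDegree (α := α) (β := β) hb
  have hlt : ∀ r < 1, (monomialMeasure α β).map (rgam n (1 / (2 * (b : ℝ)))) (Iic r) = 0 := by
    intro r hr
    rw [Measure.map_apply continuous_rgam.measurable measurableSet_Iic]
    convert measure_empty (μ := monomialMeasure α β)
    ext q
    simpa using hr.trans_le (one_le_rgam q)
  have hge : ∀ r, 1 ≤ r → (monomialMeasure α β).map (rgam n (1 / (2 * (b : ℝ)))) (Iic r) =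
      ENNReal.ofReal ((r ^ 2 - 1) ^ homDegree b α β) *
        monomialMeasure α β {q | anisotropicGauge n b q ≤ 1} := by
    intro r hr
    have hset : rgam n (1 / (2 * (b : ℝ))) ⁻¹' Iic r =
        {q | anisotropicGauge n b q ≤ r ^ 2 - 1} := by
      ext q
      exact rgam_le_iff (by linarith) q
    rw [Measure.map_apply continuous_rgam.measurable measurableSet_Iic, hset]
    rcases hr.eq_or_lt with rfl | hr'
    · rw [monomialMeasure_gauge_le_nonpos hb (by norm_num), one_pow, sub_self,
        Real.zero_rpow (by linarith), ENNReal.ofReal_zero, zero_mul]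
    · exact monomialMeasure_gauge_le_eq hb (by nlinarith)
  refine measure_ext_of_Iic_ne_top (fun r => ?_) fun r => ?_
  · rcases lt_or_ge r 1 with hr | hr
    · rw [hlt r hr]
      exact ENNReal.zero_ne_top
    · rw [hge r hr]
      exact ENNReal.mul_ne_top ENNReal.ofReal_ne_top (monomialMeasure_gauge_le_one_lt_top hb).ne
  · rcases lt_or_ge r 1 with hr | hr
    · rw [hlt r hr, Measure.smul_apply, radialMeasure_Iic_of_lt hr, smul_zero]
    · rw [hge r hr, Measure.smul_apply, radialMeasure_Iic hκ hr, smul_eq_mul, mul_comm]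

/-- With γ = 1/(2b), s > n/2 + b and δ = s − n/2 − b − |α| − 2bβ ≥ 0,
    there is a positive constant c depending only on n, b, α, β such that
    ∫∫ |ξ^α|²|η|^{2β} r_γ^{-2s} φ(r_γ)^{-2} dξ dη
      = c ∫₁^∞ (r²−1)^{s−1−δ} / (r^{2s−1} φ(r)²) dr,
    both sides simultaneously finite or infinite (stated with lower integrals). -/
theorem stmt_14 (n b : ℕ) (hn : 1 ≤ n) (hb : 1 ≤ b)
    (α : Fin n → ℕ) (β : ℕ) :
    ∃ c : ℝ, 0 < c ∧
      ∀ (s : ℝ) (φ : ℝ → ℝ), Measurable φ → (∀ r : ℝ, 1 ≤ r → 0 < φ r) →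
        (∀ d : ℝ, 1 < d → ∃ M : ℝ, ∀ r ∈ Icc (1 : ℝ) d, φ r ≤ M ∧ (φ r)⁻¹ ≤ M) →
        (n : ℝ) / 2 + b < s →
        0 ≤ s - n / 2 - b - (∑ i, (α i : ℝ)) - 2 * b * β →
        (∫⁻ q : (Fin n → ℝ) × ℝ,
            ENNReal.ofReal ((∏ i, |q.1 i| ^ (α i)) ^ 2 * |q.2| ^ (2 * β) /
              ((rgam n (1 / (2 * (b : ℝ))) q) ^ (2 * s) *
                (φ (rgam n (1 / (2 * (b : ℝ))) q)) ^ 2)))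
          = ENNReal.ofReal c *
            ∫⁻ r in Ici (1 : ℝ),
              ENNReal.ofReal ((r ^ 2 - 1) ^
                  (s - 1 - (s - n / 2 - b - (∑ i, (α i : ℝ)) - 2 * b * β)) /
                (r ^ (2 * s - 1) * (φ r) ^ 2)) := by
  set κ := homDegree b α β with hκ_def
  have hκ : 1 ≤ κ := one_le_homDegree hb
  set C := monomialMeasure α β {q | anisotropicGauge n b q ≤ 1} with hC
  have hC_top : C ≠ ⊤ := (monomialMeasure_gauge_le_one_lt_top hb).ne
  have hC_pos : 0 < C.toReal :=
    ENNReal.toReal_pos (monomialMeasure_gauge_le_one_pos hb).ne' hC_top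
  refine ⟨C.toReal * (2 * κ), by positivity, ?_⟩
  intro s φ hφ hφ_pos _ _ _
  have hexp : s - 1 - (s - n / 2 - b - (∑ i, (α i : ℝ)) - 2 * b * β) = κ - 1 := by
    rw [hκ_def, homDegree]
    ring
  have hG : Measurable fun r : ℝ => ENNReal.ofReal (1 / (r ^ (2 * s) * φ r ^ 2)) := by
    fun_prop
  have hR : Measurable (rgam n (1 / (2 * (b : ℝ)))) := continuous_rgam.measurable
  calc
    _ = ∫⁻ q, ENNReal.ofReal (monomialWeight α β q) *
          ENNReal.ofReal (1 / (rgam n (1 / (2 * (b : ℝ))) q ^ (2 * s) *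
            φ (rgam n (1 / (2 * (b : ℝ))) q) ^ 2)) := by
      refine lintegral_congr fun q => ?_
      rw [← ENNReal.ofReal_mul (monomialWeight_nonneg q), mul_one_div, monomialWeight]
    _ = ∫⁻ r, ENNReal.ofReal (1 / (r ^ (2 * s) * φ r ^ 2))
          ∂(monomialMeasure α β).map (rgam n (1 / (2 * (b : ℝ)))) := by
      rw [lintegral_map hG hR, monomialMeasure]
      exact (lintegral_withDensity_eq_lintegral_mul _
        measurable_ofReal_monomialWeight (hG.comp hR)).symm
    _ = C * ∫⁻ r in Ici (1 : ℝ), ENNReal.ofReal (2 * κ) *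
          ENNReal.ofReal ((r ^ 2 - 1) ^ (κ - 1) / (r ^ (2 * s - 1) * φ r ^ 2)) := by
      rw [map_rgam_monomialMeasure hb, lintegral_smul_measure, lintegral_radialMeasure hκ hG,
        smul_eq_mul]
      congr 1
      refine setLIntegral_congr_fun measurableSet_Ici fun r hr => ?_
      have hr1 : (1 : ℝ) ≤ r := hr
      have hr0 : 0 < r := by linarith
      have hnn : 0 ≤ (r ^ 2 - 1) ^ (κ - 1) := Real.rpow_nonneg (by nlinarith) _
      have hφr := hφ_pos r hr1
      have hpow := Real.rpow_pos_of_pos hr0 (2 * s)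
      rw [← ENNReal.ofReal_mul (by positivity), ← ENNReal.ofReal_mul (by positivity),
        Real.rpow_sub_one hr0.ne']
      congr 1
      field_simp
    _ = _ := by
      rw [lintegral_const_mul _ (by fun_prop), ← mul_assoc, ENNReal.ofReal_mul hC_pos.le,
        ENNReal.ofReal_toReal hC_top, hexp]
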